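/- Let X follow the Beta distribution with parameters α, β > 0. Then X - E[X] is (1/(4(α+β)+2))-subgaussian; in particular, E[exp(t(X - E[X]))] ≤ exp(t²/(8(α+β)+4)) for all real t. -/

import Mathlib

open MeasureTheory

/-- The Beta(α, β) probability measure on ℝ, given by its density
`x^{α-1} (1-x)^{β-1} / B(α,β)` on `[0,1]`. -/
noncomputable def betaMeasure (α β : ℝ) : Measure ℝ :=
  volume.withDensity fun x =>
    ENNReal.ofReal
      (Set.indicator (Set.Icc (0 : ℝ) 1)
        (fun x => x ^ (α - 1) * (1 - x) ^ (β - 1)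
            / (∫ t in (0 : ℝ)..1, t ^ (α - 1) * (1 - t) ^ (β - 1))) x)

/-- Integrating-factor bound for solutions of the Kummer equation with parameters `s * m`, `s`. -/
theorem kummer_le_exp {s m c : ℝ} (hs : 0 < s) (hc : 1 ≤ 4 * (s + 1) * c) {M N Q : ℝ → ℝ}
    (hM : ∀ t, HasDerivAt M (N t) t) (hN : ∀ t, HasDerivAt N (Q t) t) (hM0 : ∀ t, 0 ≤ M t)
    (hM1 : M 0 = 1) (hode : ∀ t, t * Q t + (s - t) * N t = s * m * M t) {t : ℝ} (ht : 0 ≤ t) :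
    M t ≤ Real.exp (m * t + c * t ^ 2 / 2) := by
  have hq (k l x : ℝ) : HasDerivAt (fun t => Real.exp (k * t + l * t ^ 2 / 2))
      (Real.exp (k * x + l * x ^ 2 / 2) * (k + l * x)) x := by
    convert! (((hasDerivAt_id x).const_mul k).add
      ((((hasDerivAt_id x).pow 2).const_mul l).div_const 2)).exp using 1
    simp
    ring_nf
  have hcM : Continuous M := continuous_iff_continuousAt.2 fun t => (hM t).continuousAt
  have hcN : Continuous N := continuous_iff_continuousAt.2 fun t => (hN t).continuousAt
  have hd (x : ℝ) : HasDerivAt (fun t => N t - (m + c * t) * M t)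
      (Q x - (c * M x + (m + c * x) * N x)) x := by
    have h1 : HasDerivAt (fun t : ℝ => m + c * t) c x := by
      simpa using ((hasDerivAt_id x).const_mul c).const_add m
    exact (hN x).sub (h1.mul (hM x))
  have hanti : AntitoneOn (fun t => t ^ s * Real.exp ((m - 1) * t + c * t ^ 2 / 2) *
      (N t - (m + c * t) * M t)) (Set.Ici 0) := by
    refine antitoneOn_of_hasDerivWithinAt_nonpos (f' := fun x => x ^ (s - 1) *
      Real.exp ((m - 1) * x + c * x ^ 2 / 2) * (x * M x *
        (m * (1 - m) + c * x * (1 - 2 * m) - (c * x) ^ 2 - c * (s + 1))))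
      (convex_Ici 0) ?_ ?_ ?_
    · have := Real.continuous_rpow_const hs.le
      fun_prop
    · intro x hx
      rw [interior_Ici, Set.mem_Ioi] at hx
      have h := (((Real.hasDerivAt_rpow_const (p := s) (Or.inl hx.ne')).mul
        (hq (m - 1) c x)).mul (hd x))
      refine HasDerivAt.hasDerivWithinAt (h.congr_deriv ?_)
      have hx' : x ^ s = x ^ (s - 1) * x := by
        rw [← Real.rpow_add_one hx.ne', sub_add_cancel]
      simp only [Pi.mul_apply, hx']
      linear_combination x ^ (s - 1) * Real.exp ((m - 1) * x + c * x ^ 2 / 2) * hode x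
    · intro x hx
      rw [interior_Ici, Set.mem_Ioi] at hx
      refine mul_nonpos_of_nonneg_of_nonpos (by positivity)
        (mul_nonpos_of_nonneg_of_nonpos (mul_nonneg hx.le (hM0 x)) ?_)
      nlinarith [sq_nonneg (2 * (c * x) - (1 - 2 * m))]
  have hdn {x : ℝ} (hx : 0 < x) : N x - (m + c * x) * M x ≤ 0 := by
    have h := hanti Set.self_mem_Ici hx.le hx.le
    simp only [Real.zero_rpow hs.ne', zero_mul] at h
    exact nonpos_of_mul_nonpos_right h (by positivity)
  have hanti' : AntitoneOn (fun t => M t * Real.exp ((-m) * t + (-c) * t ^ 2 / 2))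
      (Set.Ici 0) := by
    refine antitoneOn_of_hasDerivWithinAt_nonpos (convex_Ici 0) (by fun_prop)
      (fun x _ => ((hM x).mul (hq (-m) (-c) x)).hasDerivWithinAt) fun x hx => ?_
    rw [interior_Ici, Set.mem_Ioi] at hx
    have := mul_nonpos_of_nonpos_of_nonneg (hdn hx)
      (Real.exp_pos (-m * x + -c * x ^ 2 / 2)).le
    linarith
  have h := hanti' Set.self_mem_Ici ht ht
  have he : (-m) * t + (-c) * t ^ 2 / 2 = -(m * t + c * t ^ 2 / 2) := by ring
  simp only [hM1, he, Real.exp_neg] at h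
  rw [← div_eq_mul_inv, div_le_iff₀ (Real.exp_pos _)] at h
  simpa using h

/-- A probability measure on `[0, 1]` satisfying the Stein identity of the Beta distribution
against exponentials has a subgaussian one-sided moment generating function. -/
theorem mgf_le_of_stein_of_nonneg {P : Measure ℝ} [IsProbabilityMeasure P] {a b c : ℝ}
    (ha : 0 < a) (hb : 0 < b) (hc : 1 ≤ 4 * (a + b + 1) * c)
    (hP : ∀ᵐ x ∂P, x ∈ Set.Icc (0 : ℝ) 1)
    (hstein : ∀ t : ℝ, ∫ x, (a * (1 - x) - b * x + t * (x * (1 - x))) * Real.exp (t * x) ∂P = 0)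
    {t : ℝ} (ht : 0 ≤ t) :
    ∫ x, Real.exp (t * x) ∂P ≤ Real.exp (a / (a + b) * t + c * t ^ 2 / 2) := by
  have hint (u : ℝ) : u ∈ interior (ProbabilityTheory.integrableExpSet id P) := by
    have : ProbabilityTheory.integrableExpSet (id : ℝ → ℝ) P = Set.univ :=
      Set.eq_univ_of_forall fun u =>
        ProbabilityTheory.integrable_exp_mul_of_mem_Icc aemeasurable_id hP
    simp [this]
  have hd (n : ℕ) (u : ℝ) : HasDerivAt (fun u => ∫ x, x ^ n * Real.exp (u * x) ∂P)
      (∫ x, x ^ (n + 1) * Real.exp (u * x) ∂P) u :=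
    ProbabilityTheory.hasDerivAt_integral_pow_mul_exp_real (hint u) n
  have hi (n : ℕ) (u : ℝ) : Integrable (fun x => x ^ n * Real.exp (u * x)) P :=
    ProbabilityTheory.integrable_pow_mul_exp_of_mem_interior_integrableExpSet (hint u) n
  have h := kummer_le_exp (s := a + b) (m := a / (a + b)) (by positivity) hc (hd 0) (hd 1)
    (fun u => by simpa using integral_nonneg fun x => (Real.exp_pos (u * x)).le) (by simp)
    (fun u => ?_) ht
  · simpa using h
  · have e : (fun x => (a * (1 - x) - b * x + u * (x * (1 - x))) * Real.exp (u * x)) =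
        fun x => a * (x ^ 0 * Real.exp (u * x)) + (u - (a + b)) * (x ^ (0 + 1) * Real.exp (u * x))
          - u * (x ^ (1 + 1) * Real.exp (u * x)) := by
      ext x
      ring
    have h0 := hstein u
    rw [e, integral_sub (by exact ((hi 0 u).const_mul a).add ((hi (0 + 1) u).const_mul _))
      ((hi (1 + 1) u).const_mul _), integral_add ((hi 0 u).const_mul a)
      ((hi (0 + 1) u).const_mul _), integral_const_mul, integral_const_mul,
      integral_const_mul] at h0
    rw [mul_div_cancel₀ a (by positivity : a + b ≠ 0)]
    linarith

/-- Two-sided version of `mgf_le_of_stein_of_nonneg`, by the reflection `x ↦ 1 - x`. -/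
theorem mgf_le_of_stein {P : Measure ℝ} [IsProbabilityMeasure P] {a b c : ℝ}
    (ha : 0 < a) (hb : 0 < b) (hc : 1 ≤ 4 * (a + b + 1) * c)
    (hP : ∀ᵐ x ∂P, x ∈ Set.Icc (0 : ℝ) 1)
    (hstein : ∀ t : ℝ, ∫ x, (a * (1 - x) - b * x + t * (x * (1 - x))) * Real.exp (t * x) ∂P = 0)
    (t : ℝ) :
    ∫ x, Real.exp (t * x) ∂P ≤ Real.exp (a / (a + b) * t + c * t ^ 2 / 2) := by
  rcases le_total 0 t with ht | ht
  · exact mgf_le_of_stein_of_nonneg ha hb hc hP hstein ht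
  have hr : Measurable fun x : ℝ => 1 - x := by fun_prop
  have : IsProbabilityMeasure (P.map fun x => 1 - x) :=
    Measure.isProbabilityMeasure_map hr.aemeasurable
  have h := mgf_le_of_stein_of_nonneg (P := P.map fun x => 1 - x) (t := -t) (c := c) hb ha
    (by linarith) ?_ (fun u => ?_) (by linarith)
  · rw [integral_map hr.aemeasurable (by fun_prop)] at h
    have e (x : ℝ) : Real.exp (-t * (1 - x)) = Real.exp (-t) * Real.exp (t * x) := by
      rw [← Real.exp_add]
      ring_nf
    simp only [e, integral_const_mul] at h
    have hab : a + b ≠ 0 := by positivity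
    have e2 : b / (b + a) * -t + c * (-t) ^ 2 / 2 =
        -t + (a / (a + b) * t + c * t ^ 2 / 2) := by
      rw [add_comm b a]
      field_simp
      ring
    rw [e2, Real.exp_add] at h
    exact le_of_mul_le_mul_left h (Real.exp_pos _)
  · refine (ae_map_iff hr.aemeasurable measurableSet_Icc).2 ?_
    filter_upwards [hP] with x hx
    exact ⟨by linarith [hx.2], by linarith [hx.1]⟩
  · rw [integral_map hr.aemeasurable (by fun_prop)]
    have e (x : ℝ) : (b * (1 - (1 - x)) - a * (1 - x) + u * ((1 - x) * (1 - (1 - x)))) *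
        Real.exp (u * (1 - x)) = -Real.exp u *
          ((a * (1 - x) - b * x + -u * (x * (1 - x))) * Real.exp (-u * x)) := by
      have : u * (1 - x) = u + -u * x := by ring
      rw [this, Real.exp_add]
      ring
    simp only [e, integral_const_mul, hstein, mul_zero]

theorem intervalIntegrable_betaKernel {a b : ℝ} (ha : 0 < a) (hb : 0 < b) :
    IntervalIntegrable (fun x : ℝ => x ^ (a - 1) * (1 - x) ^ (b - 1)) volume 0 1 := by
  have h := (Complex.betaIntegral_convergent (u := a) (v := b) (by simpa) (by simpa)).norm
  rw [intervalIntegrable_iff_integrableOn_Ioo_of_le zero_le_one] at h ⊢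
  refine h.congr_fun (fun x hx => ?_) measurableSet_Ioo
  have h1 : (1 : ℂ) - x = ((1 - x : ℝ) : ℂ) := by push_cast; rfl
  simp only [norm_mul, h1]
  rw [Complex.norm_cpow_eq_rpow_re_of_pos hx.1,
    Complex.norm_cpow_eq_rpow_re_of_pos (sub_pos.2 hx.2)]
  simp

theorem betaKernel_integral_pos {a b : ℝ} (ha : 0 < a) (hb : 0 < b) :
    0 < ∫ x in (0 : ℝ)..1, x ^ (a - 1) * (1 - x) ^ (b - 1) :=
  intervalIntegral.intervalIntegral_pos_of_pos_on (intervalIntegrable_betaKernel ha hb)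
    (fun _ hx => mul_pos (Real.rpow_pos_of_pos hx.1 _)
      (Real.rpow_pos_of_pos (sub_pos.2 hx.2) _)) zero_lt_one

theorem integral_betaMeasure {a b : ℝ} (ha : 0 < a) (hb : 0 < b) (g : ℝ → ℝ) :
    ∫ x, g x ∂betaMeasure a b = (∫ x in (0 : ℝ)..1, x ^ (a - 1) * (1 - x) ^ (b - 1) * g x) /
      ∫ x in (0 : ℝ)..1, x ^ (a - 1) * (1 - x) ^ (b - 1) := by
  have hB := betaKernel_integral_pos ha hb
  unfold betaMeasure
  generalize (∫ x in (0 : ℝ)..1, x ^ (a - 1) * (1 - x) ^ (b - 1)) = B at hB ⊢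
  rw [integral_withDensity_eq_integral_toReal_smul
    ((Measurable.indicator (by fun_prop) measurableSet_Icc).ennreal_ofReal)
    (Filter.Eventually.of_forall fun _ => ENNReal.ofReal_lt_top),
    intervalIntegral.integral_of_le zero_le_one, ← integral_Icc_eq_integral_Ioc,
    ← integral_indicator measurableSet_Icc, ← integral_div]
  congr 1 with x
  by_cases hx : x ∈ Set.Icc (0 : ℝ) 1
  · have h1 : 0 ≤ x := hx.1
    have h2 : 0 ≤ 1 - x := sub_nonneg.2 hx.2
    rw [Set.indicator_of_mem hx, Set.indicator_of_mem hx, ENNReal.toReal_ofReal (by positivity),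
      smul_eq_mul]
    ring
  · simp [hx]

theorem isProbabilityMeasure_betaMeasure {a b : ℝ} (ha : 0 < a) (hb : 0 < b) :
    IsProbabilityMeasure (betaMeasure a b) := by
  have h := integral_betaMeasure ha hb fun _ => 1
  simp only [mul_one, div_self (betaKernel_integral_pos ha hb).ne', integral_const, smul_eq_mul,
    Measure.real] at h
  exact ⟨(ENNReal.toReal_eq_one_iff _).1 h⟩

theorem ae_mem_Icc_betaMeasure (a b : ℝ) : ∀ᵐ x ∂betaMeasure a b, x ∈ Set.Icc (0 : ℝ) 1 := by
  rw [betaMeasure, ae_withDensity_iff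
    ((Measurable.indicator (by fun_prop) measurableSet_Icc).ennreal_ofReal)]
  refine Filter.Eventually.of_forall fun x hx => ?_
  by_contra h
  simp [h] at hx

theorem betaMeasure_stein {a b : ℝ} (ha : 0 < a) (hb : 0 < b) (t : ℝ) :
    ∫ x, (a * (1 - x) - b * x + t * (x * (1 - x))) * Real.exp (t * x) ∂betaMeasure a b = 0 := by
  rw [integral_betaMeasure ha hb, div_eq_zero_iff]
  left
  rw [intervalIntegral.integral_eq_sub_of_hasDerivAt_of_le
    (f := fun x => x ^ a * (1 - x) ^ b * Real.exp (t * x)) zero_le_one]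
  · simp [ha.ne', hb.ne']
  · have h1 := Real.continuous_rpow_const ha.le
    have h2 : Continuous fun x : ℝ => (1 - x) ^ b :=
      (Real.continuous_rpow_const hb.le).comp (by fun_prop)
    fun_prop
  · intro x hx
    have hx1 : 0 < 1 - x := sub_pos.2 hx.2
    have h1 := Real.hasDerivAt_rpow_const (p := a) (Or.inl hx.1.ne')
    have h2 := ((hasDerivAt_id x).const_sub 1).rpow_const (p := b) (Or.inl hx1.ne')
    have h3 := ((hasDerivAt_id x).const_mul t).exp
    refine ((h1.mul h2).mul h3).congr_deriv ?_
    have e1 : x ^ a = x ^ (a - 1) * x := by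
      rw [← Real.rpow_add_one hx.1.ne', sub_add_cancel]
    have e2 : (1 - x) ^ b = (1 - x) ^ (b - 1) * (1 - x) := by
      rw [← Real.rpow_add_one hx1.ne', sub_add_cancel]
    simp only [Pi.mul_apply, id_eq, e1, e2]
    ring
  · exact (intervalIntegrable_betaKernel ha hb).mul_continuousOn (by fun_prop)

theorem integral_id_betaMeasure {a b : ℝ} (ha : 0 < a) (hb : 0 < b) :
    ∫ x, x ∂betaMeasure a b = a / (a + b) := by
  have := isProbabilityMeasure_betaMeasure ha hb
  have hi : Integrable (fun x : ℝ => x) (betaMeasure a b) :=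
    Integrable.of_mem_Icc 0 1 aemeasurable_id (ae_mem_Icc_betaMeasure a b)
  have h := betaMeasure_stein ha hb 0
  have e (x : ℝ) : (a * (1 - x) - b * x + 0 * (x * (1 - x))) * Real.exp (0 * x) =
      a - (a + b) * x := by
    simp
    ring
  simp only [e] at h
  rw [integral_sub (integrable_const a) (hi.const_mul _), integral_const_mul] at h
  rw [eq_div_iff (by positivity)]
  simp at h
  linarith

/-- A Beta(α, β) random variable, centered at its mean, is `(1/(4(α+β)+2))`-subgaussian:
`E[exp(t(X - E X))] ≤ exp(t²/(8(α+β)+4))` for all real `t`. -/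
theorem stmt13 (α β : ℝ) (hα : 0 < α) (hβ : 0 < β) (t : ℝ) :
    ∫ x, Real.exp (t * (x - ∫ y, y ∂betaMeasure α β)) ∂betaMeasure α β
      ≤ Real.exp (t ^ 2 / (8 * (α + β) + 4)) := by
  have := isProbabilityMeasure_betaMeasure hα hβ
  have h := mgf_le_of_stein (c := 1 / (4 * (α + β) + 2)) hα hβ ?_ (ae_mem_Icc_betaMeasure α β)
    (betaMeasure_stein hα hβ) t
  · have e (x : ℝ) : Real.exp (t * (x - α / (α + β))) =
        Real.exp (-(α / (α + β) * t)) * Real.exp (t * x) := by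
      rw [← Real.exp_add]
      ring_nf
    simp only [integral_id_betaMeasure hα hβ, e, integral_const_mul]
    refine (mul_le_mul_of_nonneg_left h (Real.exp_pos _).le).trans_eq ?_
    rw [← Real.exp_add]
    congr 1
    field_simp
    ring
  · rw [mul_one_div, le_div_iff₀ (by positivity)]
    linarith
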